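/- If R and F are braidings satisfying the compatibility conditions R₁₂F₂₃F₁₂ = F₂₃F₁₂R₂₃ and R₂₃F₁₂F₂₃ = F₁₂F₂₃R₁₂, with F invertible, and L is the generating matrix of the algebra L(R,F) defined by R₁₂ L_{1̄} L_{2̄} = L_{1̄} L_{2̄} R₁₂ (where L_{1̄} = L⊗I⊗I and L_{k+1bar} = F_{k,k+1} L_{k̄} F_{k,k+1}^{-1}), then the relation also holds in shifted positions: R₂₃ L_{2̄} L_{3̄} = L_{2̄} L_{3̄} R₂₃. -/

import Mathlib

open Matrix Kronecker

noncomputable section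

/-- The involutive symmetry R = [[1,0,0,0],[0,0,q,0],[0,q⁻¹,0,0],[0,0,0,1]] on ℂ²⊗ℂ². -/
def Rinv (q : ℂ) : Matrix (Fin 2 × Fin 2) (Fin 2 × Fin 2) ℂ :=
  Matrix.of fun p r =>
    if p = r ∧ p.1 = p.2 then 1
    else if p = (0, 1) ∧ r = (1, 0) then q
    else if p = (1, 0) ∧ r = (0, 1) then q⁻¹ else 0

/-- The standard Hecke symmetry R = [[q,0,0,0],[0,q−q⁻¹,1,0],[0,1,0,0],[0,0,0,q]]. -/
def RHecke (q : ℂ) : Matrix (Fin 2 × Fin 2) (Fin 2 × Fin 2) ℂ :=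
  Matrix.of fun p r =>
    if p = (0, 0) ∧ r = (0, 0) then q
    else if p = (1, 1) ∧ r = (1, 1) then q
    else if p = (0, 1) ∧ r = (0, 1) then q - q⁻¹
    else if p = (0, 1) ∧ r = (1, 0) then 1
    else if p = (1, 0) ∧ r = (0, 1) then 1 else 0

/-- An operator on V⊗V placed in positions (1,2) of V⊗V⊗V. -/
def pos12 {n α : Type*} [Fintype n] [DecidableEq n] [Semiring α]
    (X : Matrix (n × n) (n × n) α) : Matrix (n × n × n) (n × n × n) α :=
  Matrix.reindex (Equiv.prodAssoc n n n) (Equiv.prodAssoc n n n)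
    (X ⊗ₖ (1 : Matrix n n α))

/-- An operator on V⊗V placed in positions (2,3) of V⊗V⊗V. -/
def pos23 {n α : Type*} [Fintype n] [DecidableEq n] [Semiring α]
    (X : Matrix (n × n) (n × n) α) : Matrix (n × n × n) (n × n × n) α :=
  (1 : Matrix n n α) ⊗ₖ X

theorem aux_shift {M : Type*} [Monoid M] (a a' b b' x r s : M)
    (ha1 : a * a' = 1) (ha2 : a' * a = 1) (hb1 : b * b' = 1) (hb2 : b' * b = 1)
    (hx : b * x = x * b) (hbr : a * b * a = b * a * b)
    (hs : s * a * b = a * b * r)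
    (h : r * x * (a * x * a') = x * (a * x * a') * r) :
    s * (a * x * a') * (b * (a * x * a') * b') =
      (a * x * a') * (b * (a * x * a') * b') * s := by
  have hu1 : (a * b) * (b' * a') = 1 := by
    rw [mul_assoc, ← mul_assoc b, hb1, one_mul, ha1]
  have hu2 : (b' * a') * (a * b) = 1 := by
    rw [mul_assoc, ← mul_assoc a', ha2, one_mul, hb2]
  have hL2 : a * x * a' = (a * b) * x * (b' * a') := by
    rw [mul_assoc a b x, hx]
    simp only [mul_assoc]
    rw [← mul_assoc b b', hb1, one_mul]
  have hbr' : a' * b' * a' = b' * a' * b' := by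
    have h1 : (a' * b' * a') * (a * b * a) = 1 := by
      simp only [mul_assoc]
      rw [← mul_assoc a' a, ha2, one_mul, ← mul_assoc b' b, hb2, one_mul, ha2]
    have h2 : (b * a * b) * (b' * a' * b') = 1 := by
      simp only [mul_assoc]
      rw [← mul_assoc b b', hb1, one_mul, ← mul_assoc a a', ha1, one_mul, hb1]
    rw [hbr] at h1
    exact left_inv_eq_right_inv h1 h2
  have hL3 : b * (a * x * a') * b' = (a * b) * (a * x * a') * (b' * a') := by
    calc b * (a * x * a') * b' = b * a * (x * (b * b')) * a' * b' := by
          rw [hb1, mul_one]; simp only [mul_assoc]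
      _ = (b * a * b) * x * (b' * a' * b') := by
          rw [← mul_assoc x, ← hx]; simp only [mul_assoc]
      _ = (a * b) * (a * x * a') * (b' * a') := by
          rw [← hbr, ← hbr']; simp only [mul_assoc]
  have hprod : (a * x * a') * (b * (a * x * a') * b')
      = (a * b) * (x * (a * x * a')) * (b' * a') := by
    rw [hL3]
    generalize a * x * a' = y at *
    rw [hL2]
    generalize a * b = u at *
    generalize b' * a' = v at *
    simp only [mul_assoc]
    rw [← mul_assoc v u, hu2, one_mul]
  rw [mul_assoc s, hprod]
  generalize a * x * a' = y at *
  rw [mul_assoc s] at hs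
  generalize a * b = u at *
  generalize b' * a' = v at *
  have hv : v * s = r * v := by
    calc v * s = v * (s * u) * v := by rw [mul_assoc, mul_assoc, hu1, mul_one]
      _ = r * v := by rw [hs, ← mul_assoc, hu2, one_mul]
  calc s * (u * (x * y) * v) = (s * u) * (x * y) * v := by simp only [mul_assoc]
    _ = u * (r * x * y) * v := by rw [hs]; simp only [mul_assoc]
    _ = u * (x * y) * (r * v) := by rw [h]; simp only [mul_assoc]
    _ = u * (x * y) * v * s := by rw [← hv]; simp only [mul_assoc]

theorem pos12_mul_aux {n : Type*} [Fintype n] [DecidableEq n]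
    (X Y : Matrix (n × n) (n × n) ℂ) (h : X * Y = 1) : pos12 X * pos12 Y = 1 := by
  unfold pos12
  simp only [Matrix.reindex_apply]
  rw [Matrix.submatrix_mul_equiv, ← Matrix.mul_kronecker_mul, h, one_mul,
    Matrix.one_kronecker_one, Matrix.submatrix_one_equiv]

theorem pos23_mul_aux {n : Type*} [Fintype n] [DecidableEq n]
    (X Y : Matrix (n × n) (n × n) ℂ) (h : X * Y = 1) : pos23 X * pos23 Y = 1 := by
  unfold pos23
  rw [← Matrix.mul_kronecker_mul, h, one_mul, Matrix.one_kronecker_one]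

theorem pos23_comm_aux {n : Type*} [Fintype n] [DecidableEq n]
    {A : Type*} [Ring A] [Algebra ℂ A] (X : Matrix (n × n) (n × n) ℂ) (L : Matrix n n A) :
    (pos23 X).map (algebraMap ℂ A) * (L ⊗ₖ (1 : Matrix (n × n) (n × n) A)) =
      (L ⊗ₖ (1 : Matrix (n × n) (n × n) A)) * (pos23 X).map (algebraMap ℂ A) := by
  ext ⟨i, p⟩ ⟨j, q⟩
  simp only [Matrix.mul_apply, pos23, Matrix.map_apply, Matrix.kroneckerMap_apply,
    Fintype.sum_prod_type (α₁ := n) (α₂ := n × n), Matrix.one_apply]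
  rw [Finset.sum_eq_single i (by intro b _ hb; simp [hb.symm]) (by simp),
    Finset.sum_eq_single j (by intro b _ hb; simp [hb]) (by simp)]
  rw [Finset.sum_eq_single q (by intro b _ hb; simp [hb]) (by simp),
    Finset.sum_eq_single p (by intro b _ hb; simp [hb.symm]) (by simp)]
  simp [Algebra.commutes]

/-- for a compatible couple (R,F) with F invertible, the defining
relations of the QMA L(R,F) hold in shifted positions:
R₂₃ L_{2̄} L_{3̄} = L_{2̄} L_{3̄} R₂₃. -/
theorem stmt5 {n : Type*} [Fintype n] [DecidableEq n]
    (R F Finv : Matrix (n × n) (n × n) ℂ)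
    (hF1 : F * Finv = 1) (hF2 : Finv * F = 1)
    (hbraidR : pos12 R * pos23 R * pos12 R = pos23 R * pos12 R * pos23 R)
    (hbraidF : pos12 F * pos23 F * pos12 F = pos23 F * pos12 F * pos23 F)
    (hcompat1 : pos12 R * pos23 F * pos12 F = pos23 F * pos12 F * pos23 R)
    (hcompat2 : pos23 R * pos12 F * pos23 F = pos12 F * pos23 F * pos12 R)
    (A : Type*) [Ring A] [Algebra ℂ A]
    (L : Matrix n n A) :
    let φ : Matrix (n × n × n) (n × n × n) ℂ → Matrix (n × n × n) (n × n × n) A :=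
      fun M => M.map (algebraMap ℂ A)
    let L1 : Matrix (n × n × n) (n × n × n) A := L ⊗ₖ (1 : Matrix (n × n) (n × n) A)
    let L2 : Matrix (n × n × n) (n × n × n) A := φ (pos12 F) * L1 * φ (pos12 Finv)
    let L3 : Matrix (n × n × n) (n × n × n) A := φ (pos23 F) * L2 * φ (pos23 Finv)
    φ (pos12 R) * L1 * L2 = L1 * L2 * φ (pos12 R) →
      φ (pos23 R) * L2 * L3 = L2 * L3 * φ (pos23 R) := by
  intro φ L1 L2 L3 h
  have hφm : ∀ X Y, φ (X * Y) = φ X * φ Y := fun X Y => Matrix.map_mul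
  have hφ1 : φ 1 = 1 := Matrix.map_one _ (map_zero _) (map_one _)
  refine aux_shift (φ (pos12 F)) (φ (pos12 Finv)) (φ (pos23 F)) (φ (pos23 Finv)) L1
    (φ (pos12 R)) (φ (pos23 R)) ?_ ?_ ?_ ?_ ?_ ?_ ?_ h
  · rw [← hφm, pos12_mul_aux _ _ hF1, hφ1]
  · rw [← hφm, pos12_mul_aux _ _ hF2, hφ1]
  · rw [← hφm, pos23_mul_aux _ _ hF1, hφ1]
  · rw [← hφm, pos23_mul_aux _ _ hF2, hφ1]
  · exact pos23_comm_aux F L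
  · simp only [← hφm, hbraidF]
  · simp only [← hφm, hcompat2]
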